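/- Let q = 2^k with k odd and n ≥ 3 odd. The collection P = {B_α : α ∈ F_{q^n}^×} is a (q−1)-fold packing of PG_n(q): each B_α is a line-spread, and every 2-dimensional F_q-subspace of V = F_{q^n} ⊕ F_q·w lies in exactly q − 1 of the B_α. -/

import Mathlib

def Dform {F : Type} [Field F] (q : ℕ) (x x0 y y0 : F) : F :=
  (x * y ^ q + x ^ q * y) + (x * y0 + x0 * y) ^ (q + 1)

def lineSpan {F : Type} [Field F] (q : ℕ) (u v : F × F) : Set (F × F) :=
  {p | ∃ a b : F, a ^ q = a ∧ b ^ q = b ∧ p = (a * u.1 + b * v.1, a * u.2 + b * v.2)}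

def IndepPair {F : Type} [Field F] (q : ℕ) (x x0 y y0 : F) : Prop :=
  ∀ a b : F, a ^ q = a → b ^ q = b → a * x + b * y = 0 → a * x0 + b * y0 = 0 → a = 0 ∧ b = 0

def Bset {F : Type} [Field F] (q : ℕ) (α : F) : Set (Set (F × F)) :=
  {ℓ | ∃ x x0 y y0 : F, x0 ^ q = x0 ∧ y0 ^ q = y0 ∧ IndepPair q x x0 y y0 ∧
    ℓ = lineSpan q (x, x0) (y, y0) ∧ Dform q x x0 y y0 = α}

section CharTwo

variable {F : Type} [Field F] {q : ℕ}

theorem Dform_basis_change (h2 : (2 : F) = 0) (hadd : ∀ a b : F, (a + b) ^ q = a ^ q + b ^ q)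
    {a b c d : F} (ha : a ^ q = a) (hb : b ^ q = b) (hc : c ^ q = c) (hd : d ^ q = d)
    (x x0 y y0 : F) :
    Dform q (a * x + b * y) (a * x0 + b * y0) (c * x + d * y) (c * x0 + d * y0) =
      (a * d + b * c) * (x * y ^ q + x ^ q * y) +
        (a * d + b * c) ^ 2 * (x * y0 + x0 * y) ^ (q + 1) := by
  have hB : (a * x + b * y) * (c * x0 + d * y0) + (a * x0 + b * y0) * (c * x + d * y) =
      (a * d + b * c) * (x * y0 + x0 * y) := by
    linear_combination (a * c * x * x0 + b * d * y * y0) * h2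
  have hdet : (a * d + b * c) ^ q = a * d + b * c := by
    rw [hadd, mul_pow, mul_pow, ha, hb, hc, hd]
  unfold Dform
  rw [hB, mul_pow, pow_succ (a * d + b * c), hdet]
  simp only [hadd, mul_pow, ha, hb, hc, hd]
  linear_combination (a * c * x * x ^ q + b * d * y * y ^ q) * h2

theorem lineSpan_basis_change_subset (hadd : ∀ a b : F, (a + b) ^ q = a ^ q + b ^ q)
    {a b c d : F} (ha : a ^ q = a) (hb : b ^ q = b) (hc : c ^ q = c) (hd : d ^ q = d)
    (x x0 y y0 : F) :
    lineSpan q (a * x + b * y, a * x0 + b * y0) (c * x + d * y, c * x0 + d * y0) ⊆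
      lineSpan q (x, x0) (y, y0) := by
  rintro p ⟨s, t, hs, ht, rfl⟩
  refine ⟨s * a + t * c, s * b + t * d, ?_, ?_, ?_⟩
  · rw [hadd, mul_pow, mul_pow, hs, ht, ha, hc]
  · rw [hadd, mul_pow, mul_pow, hs, ht, hb, hd]
  · ext <;> simp only <;> ring

theorem lineSpan_basis_change (h2 : (2 : F) = 0) (hadd : ∀ a b : F, (a + b) ^ q = a ^ q + b ^ q)
    {a b c d : F} (ha : a ^ q = a) (hb : b ^ q = b) (hc : c ^ q = c) (hd : d ^ q = d)
    (hdet : a * d + b * c ≠ 0) (x x0 y y0 : F) :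
    lineSpan q (a * x + b * y, a * x0 + b * y0) (c * x + d * y, c * x0 + d * y0) =
      lineSpan q (x, x0) (y, y0) := by
  refine (lineSpan_basis_change_subset hadd ha hb hc hd x x0 y y0).antisymm ?_
  have hD : (a * d + b * c) ^ q = a * d + b * c := by
    rw [hadd, mul_pow, mul_pow, ha, hb, hc, hd]
  have key : ∀ e : F, e ^ q = e → (e / (a * d + b * c)) ^ q = e / (a * d + b * c) := by
    intro e he
    rw [div_pow, he, hD]
  have h := lineSpan_basis_change_subset hadd (key d hd) (key b hb) (key c hc) (key a ha)
    (a * x + b * y) (a * x0 + b * y0) (c * x + d * y) (c * x0 + d * y0)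
  have e1 : ∀ r s : F, d / (a * d + b * c) * (a * r + b * s) +
      b / (a * d + b * c) * (c * r + d * s) = r := by
    intro r s
    rw [div_mul_eq_mul_div, div_mul_eq_mul_div, ← add_div, div_eq_iff hdet]
    linear_combination (b * d * s) * h2
  have e2 : ∀ r s : F, c / (a * d + b * c) * (a * r + b * s) +
      a / (a * d + b * c) * (c * r + d * s) = s := by
    intro r s
    rw [div_mul_eq_mul_div, div_mul_eq_mul_div, ← add_div, div_eq_iff hdet]
    linear_combination (a * c * r) * h2
  rwa [e1, e1, e2, e2] at h

theorem indepPair_of_Dform_ne_zero (h2 : (2 : F) = 0) {x x0 y y0 : F}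
    (h : Dform q x x0 y y0 ≠ 0) : IndepPair q x x0 y y0 := by
  intro a b ha hb h1 h0
  by_contra hab
  apply h
  by_cases ha0 : a = 0
  · subst ha0
    have hb0 : b ≠ 0 := fun hb0 => hab ⟨rfl, hb0⟩
    have hy : y = 0 := by simpa [hb0] using h1
    have hy0 : y0 = 0 := by simpa [hb0] using h0
    have hq : q ≠ 0 := by
      rintro rfl
      simp at ha
    simp [Dform, hy, hy0, hq]
  · have hx : x = b / a * y := by
      field_simp
      linear_combination h1 - b * y * h2
    have hx0 : x0 = b / a * y0 := by
      field_simp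
      linear_combination h0 - b * y0 * h2
    have hB : x * y0 + x0 * y = 0 := by
      rw [hx, hx0]
      linear_combination (b / a * y * y0) * h2
    have hc : (b / a) ^ q = b / a := by rw [div_pow, ha, hb]
    rw [Dform, hB, hx, mul_pow, hc, zero_pow q.succ_ne_zero]
    linear_combination (b / a * y * y ^ q) * h2

theorem mem_Bset_through_iff (h2 : (2 : F) = 0) (hadd : ∀ a b : F, (a + b) ^ q = a ^ q + b ^ q)
    (hq : q ≠ 0) {α : F} (hα : α ≠ 0) {x x0 : F} (hx0 : x0 ^ q = x0)
    (hv : (x, x0) ≠ (0 : F × F)) (l : Set (F × F)) :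
    (l ∈ Bset q α ∧ (x, x0) ∈ l) ↔
      ∃ y y0 : F, y0 ^ q = y0 ∧ Dform q x x0 y y0 = α ∧ l = lineSpan q (x, x0) (y, y0) := by
  have h0 : (0 : F) ^ q = 0 := zero_pow hq
  constructor
  · rintro ⟨⟨r, r0, s, s0, hr0, hs0, -, rfl, hD⟩, a, b, ha, hb, hab⟩
    obtain ⟨rfl, rfl⟩ : x = a * r + b * s ∧ x0 = a * r0 + b * s0 := by
      simpa [Prod.ext_iff] using hab
    have main : ∀ c d : F, c ^ q = c → d ^ q = d → a * d + b * c = 1 →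
        ∃ y y0 : F, y0 ^ q = y0 ∧ Dform q (a * r + b * s) (a * r0 + b * s0) y y0 = α ∧
          lineSpan q (r, r0) (s, s0) =
            lineSpan q (a * r + b * s, a * r0 + b * s0) (y, y0) := by
      intro c d hc hd hdet
      refine ⟨c * r + d * s, c * r0 + d * s0, ?_, ?_, ?_⟩
      · rw [hadd, mul_pow, mul_pow, hc, hd, hr0, hs0]
      · rw [Dform_basis_change h2 hadd ha hb hc hd, hdet, ← hD, Dform]
        ring
      · rw [lineSpan_basis_change h2 hadd ha hb hc hd (by rw [hdet]; exact one_ne_zero)]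
    by_cases ha0 : a = 0
    · have hb0 : b ≠ 0 := by
        rintro rfl
        exact hv (by simp [ha0])
      exact main b⁻¹ 0 (by rw [inv_pow, hb]) h0 (by simp [hb0])
    · exact main 0 a⁻¹ h0 (by rw [inv_pow, ha]) (by simp [ha0])
  · rintro ⟨y, y0, hy0, hD, rfl⟩
    exact ⟨⟨x, x0, y, y0, hx0, hy0, indepPair_of_Dform_ne_zero h2 (hD ▸ hα), rfl, hD⟩,
      1, 0, one_pow q, h0, by simp⟩

theorem lineSpan_add_smul (h2 : (2 : F) = 0) (hadd : ∀ a b : F, (a + b) ^ q = a ^ q + b ^ q)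
    (hq : q ≠ 0) {c : F} (hc : c ^ q = c) (x x0 y y0 : F) :
    lineSpan q (x, x0) (y + c * x, y0 + c * x0) = lineSpan q (x, x0) (y, y0) := by
  have h := lineSpan_basis_change (q := q) h2 hadd (one_pow q) (zero_pow hq) hc (one_pow q)
    (by simp) x x0 y y0
  simpa [add_comm] using h

theorem Dform_add_smul (h2 : (2 : F) = 0) (hadd : ∀ a b : F, (a + b) ^ q = a ^ q + b ^ q)
    (hq : q ≠ 0) {c : F} (hc : c ^ q = c) (x x0 y y0 : F) :
    Dform q x x0 (y + c * x) (y0 + c * x0) = Dform q x x0 y y0 := by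
  have h := Dform_basis_change (q := q) h2 hadd (one_pow q) (zero_pow hq) hc (one_pow q) x x0 y y0
  simpa [add_comm, Dform] using h

theorem lineSpan_mem_Bset_iff (h2 : (2 : F) = 0) (hadd : ∀ a b : F, (a + b) ^ q = a ^ q + b ^ q)
    (hq : q ≠ 0) {α : F} (hα : α ≠ 0) {x x0 y y0 : F} (hx0 : x0 ^ q = x0) (hy0 : y0 ^ q = y0) :
    lineSpan q (x, x0) (y, y0) ∈ Bset q α ↔
      ∃ d : F, d ^ q = d ∧ d ≠ 0 ∧
        d * (x * y ^ q + x ^ q * y) + d ^ 2 * (x * y0 + x0 * y) ^ (q + 1) = α := by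
  have h0 : (0 : F) ^ q = 0 := zero_pow hq
  constructor
  · rintro ⟨r, r0, s, s0, hr0, hs0, -, hl, hD⟩
    have hr : (r, r0) ∈ lineSpan q (x, x0) (y, y0) := hl ▸ ⟨1, 0, one_pow q, h0, by simp⟩
    have hs : (s, s0) ∈ lineSpan q (x, x0) (y, y0) := hl ▸ ⟨0, 1, h0, one_pow q, by simp⟩
    obtain ⟨a, b, ha, hb, hab⟩ := hr
    obtain ⟨c, d, hc, hd, hcd⟩ := hs
    obtain ⟨rfl, rfl⟩ : r = a * x + b * y ∧ r0 = a * x0 + b * y0 := by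
      simpa [Prod.ext_iff] using hab
    obtain ⟨rfl, rfl⟩ : s = c * x + d * y ∧ s0 = c * x0 + d * y0 := by
      simpa [Prod.ext_iff] using hcd
    rw [Dform_basis_change h2 hadd ha hb hc hd] at hD
    refine ⟨a * d + b * c, ?_, ?_, hD⟩
    · rw [hadd, mul_pow, mul_pow, ha, hb, hc, hd]
    · intro hz
      apply hα
      rw [← hD, hz]
      ring
  · rintro ⟨d, hd, hd0, hD⟩
    have hl := lineSpan_basis_change (q := q) h2 hadd hd h0 h0 (one_pow q) (by simpa using hd0)
      x x0 y y0
    have hD' := Dform_basis_change (q := q) h2 hadd hd h0 h0 (one_pow q) x x0 y y0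
    simp only [zero_mul, add_zero, zero_add, one_mul, mul_one] at hl hD'
    rw [hD] at hD'
    exact ⟨d * x, d * x0, y, y0, by rw [mul_pow, hd, hx0], hy0,
      indepPair_of_Dform_ne_zero h2 (hD' ▸ hα), hl.symm, hD'⟩

theorem pow_pow_of_pow_eq {a : F} (ha : a ^ q = a) (i : ℕ) : a ^ q ^ i = a := by
  induction i with
  | zero => simp
  | succ i ih => rw [pow_succ, pow_mul, ih, ha]

/-- The trace to the fixed field of `a ↦ a ^ q`, as a sum of conjugates. -/
def conjSum (q n : ℕ) (t : F) : F := ∑ i ∈ Finset.range n, t ^ q ^ i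

theorem add_pow_pow_of_additive (hadd : ∀ a b : F, (a + b) ^ q = a ^ q + b ^ q) (i : ℕ)
    (a b : F) : (a + b) ^ q ^ i = a ^ q ^ i + b ^ q ^ i := by
  induction i with
  | zero => simp
  | succ i ih => rw [pow_succ, pow_mul, ih, hadd, ← pow_mul, ← pow_mul]

theorem conjSum_add (hadd : ∀ a b : F, (a + b) ^ q = a ^ q + b ^ q) (n : ℕ) (a b : F) :
    conjSum q n (a + b) = conjSum q n a + conjSum q n b := by
  simp only [conjSum, add_pow_pow_of_additive hadd, Finset.sum_add_distrib]

theorem conjSum_of_pow_eq (h2 : (2 : F) = 0) {n : ℕ} (hn : Odd n) {a : F} (ha : a ^ q = a) :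
    conjSum q n a = a := by
  obtain ⟨m, rfl⟩ := hn
  simp only [conjSum, pow_pow_of_pow_eq ha, Finset.sum_const, Finset.card_range, nsmul_eq_mul]
  push_cast
  linear_combination (m * a) * h2

theorem conjSum_pow_arg {n : ℕ} (hfix : ∀ a : F, a ^ q ^ n = a) (t : F) :
    conjSum q n (t ^ q) = conjSum q n t := by
  have h := Finset.sum_range_succ' (fun i => t ^ q ^ i) n
  rw [Finset.sum_range_succ] at h
  simp only [hfix, pow_zero, pow_one, add_left_inj] at h
  simp only [conjSum, ← pow_mul, ← pow_succ', h]

theorem conjSum_pow (hadd : ∀ a b : F, (a + b) ^ q = a ^ q + b ^ q) (hq : q ≠ 0) {n : ℕ}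
    (hfix : ∀ a : F, a ^ q ^ n = a) (t : F) : conjSum q n t ^ q = conjSum q n t := by
  have h : ∀ m, conjSum q m t ^ q = conjSum q m (t ^ q) := by
    intro m
    induction m with
    | zero => simp [conjSum, hq]
    | succ m ih =>
      simp only [conjSum] at ih ⊢
      rw [Finset.sum_range_succ, Finset.sum_range_succ, hadd, ih, ← pow_mul, ← pow_mul,
        mul_comm q]
  rw [h, conjSum_pow_arg hfix]

theorem conjSum_pow_add_self (h2 : (2 : F) = 0) (hadd : ∀ a b : F, (a + b) ^ q = a ^ q + b ^ q)
    {n : ℕ} (hfix : ∀ a : F, a ^ q ^ n = a) (t : F) : conjSum q n (t ^ q + t) = 0 := by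
  rw [conjSum_add hadd, conjSum_pow_arg hfix]
  linear_combination conjSum q n t * h2

theorem exists_pow_add_self_eq (h2 : (2 : F) = 0)
    (hadd : ∀ a b : F, (a + b) ^ q = a ^ q + b ^ q) (hq : q ≠ 0) {n : ℕ} (hn : Odd n) (t : F) :
    ∃ s : F, s ^ q + s + conjSum q n t = t := by
  obtain ⟨m, rfl⟩ := hn
  induction m with
  | zero => exact ⟨0, by simp [conjSum, hq]⟩
  | succ m ih =>
    obtain ⟨s, hs⟩ := ih
    refine ⟨s + t ^ q ^ (2 * m + 1), ?_⟩
    have e : conjSum q (2 * (m + 1) + 1) t =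
        conjSum q (2 * m + 1) t + t ^ q ^ (2 * m + 1) + t ^ q ^ (2 * m + 2) := by
      simp only [conjSum, show 2 * (m + 1) + 1 = 2 * m + 1 + 1 + 1 by ring, Finset.sum_range_succ]
    rw [e, hadd, ← pow_mul, ← pow_succ]
    linear_combination hs + (t ^ q ^ (2 * m + 1) + t ^ q ^ (2 * m + 2)) * h2

theorem sq_injective_of_two_eq_zero (h2 : (2 : F) = 0) {a b : F} (h : a ^ 2 = b ^ 2) : a = b := by
  have : (a - b) ^ 2 = 0 := by linear_combination h + (b ^ 2 - a * b) * h2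
  exact sub_eq_zero.mp (pow_eq_zero_iff two_ne_zero |>.mp this)

theorem pow_succ_injective (h2 : (2 : F) = 0) {n : ℕ} (hn : Odd n)
    (hfix : ∀ a : F, a ^ q ^ n = a) : Function.Injective fun a : F => a ^ (q + 1) := by
  have one : ∀ z : F, z ^ (q + 1) = 1 → z = 1 := by
    intro z hz
    have hz0 : z ≠ 0 := by
      rintro rfl
      simp at hz
    have hq : z ^ q = z⁻¹ := by
      rw [pow_succ] at hz
      exact eq_inv_of_mul_eq_one_left hz
    have hq2 : z ^ q ^ 2 = z := by rw [pow_two, pow_mul, hq, inv_pow, hq, inv_inv]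
    obtain ⟨m, rfl⟩ := hn
    have h := hfix z
    rw [pow_succ, pow_mul q, pow_mul, pow_pow_of_pow_eq hq2, hq] at h
    apply sq_injective_of_two_eq_zero h2
    rw [one_pow, pow_two]
    nth_rewrite 1 [← h]
    exact inv_mul_cancel₀ hz0
  intro a b hab
  simp only at hab
  by_cases hb : b = 0
  · subst hb
    simpa using hab
  · have := one (a / b) (by rw [div_pow, hab, div_self (pow_ne_zero _ hb)])
    rwa [div_eq_one_iff_eq hb] at this

theorem alternating_ne_mul_norm (h2 : (2 : F) = 0)
    (hadd : ∀ a b : F, (a + b) ^ q = a ^ q + b ^ q) (hq : q ≠ 0) {n : ℕ} (hn : Odd n)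
    (hfix : ∀ a : F, a ^ q ^ n = a) {x x0 y y0 : F} (hx0 : x0 ^ q = x0) (hy0 : y0 ^ q = y0)
    (hi : IndepPair q x x0 y y0) {d : F} (hd : d ^ q = d) (hd0 : d ≠ 0) :
    x * y ^ q + x ^ q * y + d * (x * y0 + x0 * y) ^ (q + 1) ≠ 0 := by
  intro h
  have h0 : (0 : F) ^ q = 0 := zero_pow hq
  have hBq : (x * y0 + x0 * y) ^ q = x ^ q * y0 + x0 * y ^ q := by
    rw [hadd, mul_pow, mul_pow, hx0, hy0]
  by_cases hB : x * y0 + x0 * y = 0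
  · have hz := hi y0 x0 hy0 hx0 (by linear_combination hB)
      (by linear_combination (x0 * y0) * h2)
    obtain ⟨rfl, rfl⟩ := hz
    by_cases hy : y = 0
    · exact one_ne_zero (hi 0 1 h0 (one_pow q) (by simp [hy]) (by simp)).2
    · have hc : (x / y) ^ q = x / y := by
        rw [div_pow, div_eq_div_iff (pow_ne_zero _ hy) hy]
        rw [hB, zero_pow q.succ_ne_zero] at h
        linear_combination h - x * y ^ q * h2
      refine one_ne_zero (hi 1 (x / y) (one_pow q) hc ?_ (by simp)).1
      field_simp
      linear_combination x * h2
  · have main : ∀ z c : F, c ^ q = c → c ≠ 0 → (x * y ^ q + x ^ q * y) * c =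
        (x * y0 + x0 * y) * z ^ q + (x * y0 + x0 * y) ^ q * z → False := by
      intro z c hc hc0 hA
      generalize x * y0 + x0 * y = B at *
      have e : (z / B) ^ q + z / B = c * d := by
        rw [div_pow]
        have hBq0 := pow_ne_zero q hB
        field_simp
        rw [pow_succ] at h
        linear_combination c * h - hA - c * d * B * B ^ q * h2
      have e2 := conjSum_pow_add_self h2 hadd hfix (z / B)
      rw [e, conjSum_of_pow_eq h2 hn (by rw [mul_pow, hc, hd])] at e2
      exact mul_ne_zero hc0 hd0 e2
    by_cases hy : y0 = 0
    · have hx : x0 ≠ 0 := by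
        rintro rfl
        exact hB (by simp [hy])
      refine main x x0 hx0 hx ?_
      rw [hBq]
      linear_combination - (x * x ^ q * y0) * h2
    · refine main y y0 hy0 hy ?_
      rw [hBq]
      linear_combination - (y * y ^ q * x0) * h2

theorem existsUnique_Bset_through_of_snd_ne_zero [Finite F] (h2 : (2 : F) = 0)
    (hadd : ∀ a b : F, (a + b) ^ q = a ^ q + b ^ q) (hq : q ≠ 0) {n : ℕ} (hn : Odd n)
    (hfix : ∀ a : F, a ^ q ^ n = a) {α : F} (hα : α ≠ 0) {x x0 : F} (hx0 : x0 ^ q = x0)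
    (hne : x0 ≠ 0) : ∃! l : Set (F × F), l ∈ Bset q α ∧ (x, x0) ∈ l := by
  have hinj := pow_succ_injective h2 hn hfix
  have hD : ∀ y : F, (x + x0 ^ 2 * y) ^ (q + 1) = x ^ (q + 1) + x0 ^ 2 * Dform q x x0 y 0 := by
    intro y
    simp only [Dform, mul_zero, zero_add, pow_succ, hadd, mul_pow, hx0, pow_zero, one_mul]
    ring
  have hiff := mem_Bset_through_iff h2 hadd hq hα hx0 (x := x) (by simp [Prod.ext_iff, hne])
  obtain ⟨z, hz⟩ := (Finite.injective_iff_surjective.mp hinj) (x ^ (q + 1) + x0 ^ 2 * α)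
  simp only at hz
  have hx02 : x0 ^ 2 ≠ 0 := pow_ne_zero 2 hne
  have hzy : x + x0 ^ 2 * ((z - x) / x0 ^ 2) = z := by
    field_simp
    ring
  refine ⟨lineSpan q (x, x0) ((z - x) / x0 ^ 2, 0), (hiff _).mpr ⟨_, 0, zero_pow hq, ?_, rfl⟩, ?_⟩
  · have h := hD ((z - x) / x0 ^ 2)
    rw [hzy, hz] at h
    exact (mul_left_cancel₀ hx02 (add_left_cancel h)).symm
  · intro l hl
    obtain ⟨y, y0, hy0, hDy, rfl⟩ := (hiff l).mp hl
    have hc : (y0 / x0) ^ q = y0 / x0 := by rw [div_pow, hy0, hx0]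
    have e0 : y0 + y0 / x0 * x0 = 0 := by
      field_simp
      linear_combination y0 * h2
    rw [← lineSpan_add_smul h2 hadd hq hc, e0]
    rw [← Dform_add_smul h2 hadd hq hc, e0] at hDy
    have h := hD (y + y0 / x0 * x)
    rw [hDy, ← hz] at h
    have h' := hinj h
    rw [← hzy] at h'
    rw [mul_left_cancel₀ hx02 (add_left_cancel h')]

theorem existsUnique_Bset_through_of_snd_eq_zero [Finite F] (h2 : (2 : F) = 0)
    (hadd : ∀ a b : F, (a + b) ^ q = a ^ q + b ^ q) (hq : q ≠ 0) {n : ℕ} (hn : Odd n)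
    (hfix : ∀ a : F, a ^ q ^ n = a) {α : F} (hα : α ≠ 0) {x : F} (hx : x ≠ 0) :
    ∃! l : Set (F × F), l ∈ Bset q α ∧ (x, 0) ∈ l := by
  have hxq : x ^ q ≠ 0 := pow_ne_zero q hx
  have hD : ∀ y y0 : F, y0 ^ q = y0 →
      Dform q x 0 y y0 / x ^ (q + 1) = (y / x) ^ q + y / x + y0 ^ 2 := by
    intro y y0 hy0
    simp only [Dform, zero_mul, add_zero, pow_succ, mul_pow, hy0, div_pow, pow_zero, one_mul]
    field_simp
  have hiff := mem_Bset_through_iff h2 hadd hq hα (zero_pow hq) (x := x)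
    (by simp [Prod.ext_iff, hx])
  have hsq : Function.Injective fun a : F => a ^ 2 := fun a b h =>
    sq_injective_of_two_eq_zero h2 h
  set β := α / x ^ (q + 1)
  obtain ⟨t0, ht0⟩ := (Finite.injective_iff_surjective.mp hsq) (conjSum q n β)
  simp only at ht0
  have ht0q : t0 ^ q = t0 := by
    apply hsq
    simp only
    rw [← pow_mul, mul_comm, pow_mul, ht0, conjSum_pow hadd hq hfix]
  obtain ⟨t, ht⟩ := exists_pow_add_self_eq h2 hadd hq hn β
  rw [← ht0] at ht
  refine ⟨lineSpan q (x, 0) (t * x, t0), (hiff _).mpr ⟨_, _, ht0q, ?_, rfl⟩, ?_⟩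
  · have h := hD (t * x) t0 ht0q
    rw [mul_div_cancel_right₀ _ hx, ht] at h
    exact (div_left_inj' (pow_ne_zero _ hx)).mp h
  · intro l hl
    obtain ⟨y, y0, hy0, hDy, rfl⟩ := (hiff l).mp hl
    have h := hD y y0 hy0
    rw [hDy] at h
    change β = _ at h
    obtain rfl : y0 = t0 := by
      apply hsq
      simp only
      rw [ht0, h, conjSum_add hadd, conjSum_pow_add_self h2 hadd hfix, zero_add,
        conjSum_of_pow_eq h2 hn (by rw [← pow_mul, mul_comm, pow_mul, hy0])]
    have hc : (y / x + t) ^ q = y / x + t := by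
      rw [hadd]
      linear_combination ht - h + (β - y / x - t - y0 ^ 2) * h2
    have e : t * x + (y / x + t) * x = y := by
      field_simp
      linear_combination t * x * h2
    have := lineSpan_add_smul h2 hadd hq hc x 0 (t * x) y0
    rwa [e, mul_zero, add_zero] at this

end CharTwo

theorem ncard_pow_eq_self_ne_zero {F : Type} [Field F] [Fintype F] {q n : ℕ} (hq : 1 < q)
    (hF : Fintype.card F = q ^ n) : {a : F | a ^ q = a ∧ a ≠ 0}.ncard = q - 1 := by
  have hdvd : q - 1 ∣ Nat.card Fˣ := by
    rw [Nat.card_units, Nat.card_eq_fintype_card, hF]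
    simpa using Nat.sub_dvd_pow_sub_pow q 1 n
  have hker := IsCyclic.card_powMonoidHom_ker (G := Fˣ) (q - 1)
  rw [Nat.gcd_eq_right hdvd] at hker
  have himg : {a : F | a ^ q = a ∧ a ≠ 0} =
      (fun u : Fˣ => (u : F)) '' ((powMonoidHom (q - 1) : Fˣ →* Fˣ).ker : Set Fˣ) := by
    ext a
    have hsucc : q = (q - 1) + 1 := by omega
    constructor
    · rintro ⟨ha, ha0⟩
      refine ⟨Units.mk0 a ha0, ?_, rfl⟩
      rw [SetLike.mem_coe, MonoidHom.mem_ker, powMonoidHom_apply, Units.ext_iff]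
      rw [hsucc, pow_succ] at ha
      simpa using mul_right_cancel₀ ha0 (ha.trans (one_mul a).symm)
    · rintro ⟨u, hu, rfl⟩
      rw [SetLike.mem_coe, MonoidHom.mem_ker, powMonoidHom_apply, Units.ext_iff] at hu
      refine ⟨?_, u.ne_zero⟩
      simp only [Units.val_pow_eq_pow_val, Units.val_one] at hu
      simp only
      rw [hsucc, pow_succ, hu, one_mul]
  rw [himg, Set.ncard_image_of_injective _ Units.val_injective]
  exact hker

theorem stmt17 (k n : ℕ) (hk : Odd k) (hn : Odd n) (hn3 : 3 ≤ n)
    (q : ℕ) (hq : q = 2 ^ k)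
    (F : Type) [Field F] [Fintype F] (hF : Fintype.card F = q ^ n) :
    (∀ α : F, α ≠ 0 → ∀ v : F × F, v.2 ^ q = v.2 → v ≠ 0 →
      ∃! ℓ : Set (F × F), ℓ ∈ Bset q α ∧ v ∈ ℓ) ∧
    (∀ x y x0 y0 : F, x0 ^ q = x0 → y0 ^ q = y0 → IndepPair q x x0 y y0 →
      {α : F | α ≠ 0 ∧ lineSpan q (x, x0) (y, y0) ∈ Bset q α}.ncard = q - 1) := by
  have hk0 : k ≠ 0 := by
    rintro rfl
    simp at hk
  have hq1 : 1 < q := hq ▸ Nat.one_lt_two_pow hk0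
  have hq0 : q ≠ 0 := by omega
  have hchar : CharP F 2 := charP_of_card_eq_prime_pow (f := k * n) (by
    rw [hF, hq, pow_mul])
  have h2 : (2 : F) = 0 := CharTwo.two_eq_zero
  have hadd : ∀ a b : F, (a + b) ^ q = a ^ q + b ^ q := by
    intro a b
    rw [hq, add_pow_char_pow]
  have hfix : ∀ a : F, a ^ q ^ n = a := fun a => hF ▸ FiniteField.pow_card a
  refine ⟨?_, ?_⟩
  · rintro α hα ⟨x, x0⟩ hx0 hv
    by_cases h : x0 = 0
    · subst h
      refine existsUnique_Bset_through_of_snd_eq_zero h2 hadd hq0 hn hfix hα ?_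
      rintro rfl
      exact hv rfl
    · exact existsUnique_Bset_through_of_snd_ne_zero h2 hadd hq0 hn hfix hα hx0 h
  · intro x y x0 y0 hx0 hy0 hi
    have hne := fun {d : F} => alternating_ne_mul_norm h2 hadd hq0 hn hfix hx0 hy0 hi (d := d)
    have himg : {α : F | α ≠ 0 ∧ lineSpan q (x, x0) (y, y0) ∈ Bset q α} =
        (fun d : F => d * (x * y ^ q + x ^ q * y) + d ^ 2 * (x * y0 + x0 * y) ^ (q + 1)) ''
          {d : F | d ^ q = d ∧ d ≠ 0} := by
      ext α
      constructor
      · rintro ⟨hα, hl⟩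
        obtain ⟨d, hd, hd0, h⟩ := (lineSpan_mem_Bset_iff h2 hadd hq0 hα hx0 hy0).mp hl
        exact ⟨d, ⟨hd, hd0⟩, h⟩
      · rintro ⟨d, ⟨hd, hd0⟩, h⟩
        have hα : α ≠ 0 := by
          rw [← h]
          convert mul_ne_zero hd0 (hne hd hd0) using 1
          ring
        exact ⟨hα, (lineSpan_mem_Bset_iff h2 hadd hq0 hα hx0 hy0).mpr ⟨d, hd, hd0, h⟩⟩
    rw [himg, Set.InjOn.ncard_image, ncard_pow_eq_self_ne_zero hq1 hF]
    rintro d ⟨hd, -⟩ e ⟨he, -⟩ hde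
    simp only at hde
    by_contra hne'
    have hs0 : d + e ≠ 0 := by
      rwa [Ne, CharTwo.add_eq_zero]
    refine mul_ne_zero hs0 (hne (d := d + e) (by rw [hadd, hd, he]) hs0) ?_
    linear_combination hde + (e * (x * y ^ q + x ^ q * y) +
      (d * e + e ^ 2) * (x * y0 + x0 * y) ^ (q + 1)) * h2
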